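/- Let {X_n, n ≥ 1} be a strictly stationary sequence of associated random variables with |X_n| ≤ C_1 < ∞ for all n, and assume Σ_{j=n+1}^∞ Cov(X_1, X_j) = O(n^{−4}). Let ℓ = ℓ_n = ⌊n^{3/5}⌋, Ȳ_n = (1/n) Σ_{i=1}^n ρ_1(X_i), S_j(ℓ) = Σ_{i=j+1}^{j+ℓ} ρ_1(X_i), and B_n = (1/(n−ℓ+1)) Σ_{j=0}^{n−ℓ} |S_j(ℓ) − ℓ Ȳ_n| / √ℓ. Let B̂_n be defined in the same way with ρ_1 replaced by its empirical version ρ̂_1(x) = (1/n) Σ_{j=1}^n |X_j − x|. Then |B_n − B̂_n| → 0 almost surely as n → ∞. -/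

import Mathlib

open MeasureTheory ProbabilityTheory Filter Topology

noncomputable section

variable {Ω : Type*} [MeasurableSpace Ω]

/-- Covariance of two real-valued random variables. -/
def cov (μ : Measure Ω) (f g : Ω → ℝ) : ℝ :=
  ∫ ω, f ω * g ω ∂μ - (∫ ω, f ω ∂μ) * (∫ ω, g ω ∂μ)

/-- A family of real-valued random variables is *associated* if every two coordinatewise
nondecreasing functions of any finite subcollection have nonnegative covariance
(whenever the relevant integrals exist). -/
def IsAssociated (μ : Measure Ω) {ι : Type*} (X : ι → Ω → ℝ) : Prop :=
  ∀ (S : Finset ι) (h g : (S → ℝ) → ℝ), Monotone h → Monotone g →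
    Measurable h → Measurable g →
    Integrable (fun ω => h fun i => X i ω) μ →
    Integrable (fun ω => g fun i => X i ω) μ →
    Integrable (fun ω => h (fun i => X i ω) * g (fun i => X i ω)) μ →
    0 ≤ cov μ (fun ω => h fun i => X i ω) (fun ω => g fun i => X i ω)

/-- Strict stationarity of the sequence `X 1, X 2, ...`. -/
def StrictStationary (μ : Measure Ω) (X : ℕ → Ω → ℝ) : Prop :=
  ∀ k n : ℕ, Measure.map (fun ω => fun i : Fin n => X (1 + (i : ℕ) + k) ω) μ =
    Measure.map (fun ω => fun i : Fin n => X (1 + (i : ℕ)) ω) μ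

/-- Convergence in distribution to the standard normal law `N(0,1)`. -/
def TendstoStdGaussian (μ : Measure Ω) (Z : ℕ → Ω → ℝ) : Prop :=
  ∀ f : BoundedContinuousFunction ℝ ℝ,
    Tendsto (fun n => ∫ ω, f (Z n ω) ∂μ) atTop
      (𝓝 (∫ x, f x ∂(gaussianReal 0 1)))

/-- `ρ₁(x) = ∫ |x − y| dF(y)` where `F` is the law of `X₁`. -/
def rho1 (μ : Measure Ω) (X1 : Ω → ℝ) (x : ℝ) : ℝ := ∫ y, |x - y| ∂(μ.map X1)

/-- Gini mean difference parameter `θ = ∫∫ |x − y| dF(x) dF(y)`. -/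
def giniTheta (μ : Measure Ω) (X1 : Ω → ℝ) : ℝ := ∫ x, rho1 μ X1 x ∂(μ.map X1)

/-- Degenerate part of the Gini kernel: `h⁽²⁾(x,y) = |x−y| − ρ₁(x) − ρ₁(y) + θ`. -/
def h2 (μ : Measure Ω) (X1 : Ω → ℝ) (x y : ℝ) : ℝ :=
  |x - y| - rho1 μ X1 x - rho1 μ X1 y + giniTheta μ X1

/-- `X` has a bounded probability density (w.r.t. Lebesgue measure). -/
def HasBddDensity (μ : Measure Ω) (X : Ω → ℝ) : Prop :=
  ∃ d : ℝ → ℝ, Measurable d ∧ (∃ M : ℝ, ∀ x, d x ≤ M) ∧ (∀ x, 0 ≤ d x) ∧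
    μ.map X = volume.withDensity (fun x => ENNReal.ofReal (d x))

/-- Block length `ℓ_n = ⌊n^{3/5}⌋`. -/
def blockLen (n : ℕ) : ℕ := Nat.floor ((n : ℝ) ^ ((3 : ℝ) / 5))

/-- The statistic `B_n` built from the (possibly sample-dependent) variables `Y n i`:
`B_n = (n−ℓ+1)⁻¹ ∑_{j=0}^{n−ℓ} |S_j(ℓ) − ℓ Ȳ_n|/√ℓ` with `S_j(ℓ) = ∑_{i=j+1}^{j+ℓ} Y n i`
and `Ȳ_n = n⁻¹ ∑_{i=1}^n Y n i`, `ℓ = ⌊n^{3/5}⌋`. -/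
def Bgen (Y : ℕ → ℕ → Ω → ℝ) (n : ℕ) (ω : Ω) : ℝ :=
  (1 / ((n : ℝ) - (blockLen n : ℝ) + 1)) * ∑ j ∈ Finset.range (n - blockLen n + 1),
    |(∑ i ∈ Finset.Icc (j + 1) (j + blockLen n), Y n i ω) -
        (blockLen n : ℝ) * ((1 / (n : ℝ)) * ∑ i ∈ Finset.Icc 1 n, Y n i ω)| /
      Real.sqrt (blockLen n : ℝ)

/-- The empirical version `ρ̂₁(x) = n⁻¹ ∑_{j=1}^n |X_j − x|`. -/
def rhoHat (X : ℕ → Ω → ℝ) (n : ℕ) (ω : Ω) (x : ℝ) : ℝ :=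
  (1 / (n : ℝ)) * ∑ j ∈ Finset.Icc 1 n, |X j ω - x|

theorem memLp_comp_of_abs_le {μ : Measure Ω} [IsProbabilityMeasure μ] {Y : Ω → ℝ}
    (hY : Measurable Y) {C : ℝ} (hC : ∀ ω, |Y ω| ≤ C) {f : ℝ → ℝ} (hf : Continuous f)
    (p : ENNReal) : MemLp (fun ω => f (Y ω)) p μ := by
  obtain ⟨B, hB⟩ := (isCompact_Icc (a := -C) (b := C)).exists_bound_of_continuousOn hf.continuousOn
  exact MemLp.of_bound (hf.measurable.comp hY).aestronglyMeasurable B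
    (ae_of_all _ fun ω => hB _ (abs_le.mp (hC ω)))

/-- Sums of a nondecreasing function along an associated family are positively correlated. -/
theorem IsAssociated.covariance_sum_nonneg {μ : Measure Ω} [IsProbabilityMeasure μ]
    {X : ℕ → Ω → ℝ} (hX : IsAssociated μ X) (s : Finset ℕ) {φ ψ : ℝ → ℝ}
    (hφ : Monotone φ) (hψ : Monotone ψ)
    (hφL : ∀ i ∈ s, MemLp (fun ω => φ (X i ω)) 2 μ)
    (hψL : ∀ i ∈ s, MemLp (fun ω => ψ (X i ω)) 2 μ) :
    0 ≤ cov[fun ω => ∑ i ∈ s, φ (X i ω), fun ω => ∑ i ∈ s, ψ (X i ω); μ] := by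
  have h1 : MemLp (fun ω => ∑ i ∈ s, φ (X i ω)) 2 μ := memLp_finsetSum _ hφL
  have h2 : MemLp (fun ω => ∑ i ∈ s, ψ (X i ω)) 2 μ := memLp_finsetSum _ hψL
  have e : ∀ (χ : ℝ → ℝ) (ω : Ω), ∑ i : s, χ (X i ω) = ∑ i ∈ s, χ (X i ω) := fun χ ω =>
    Finset.sum_coe_sort s fun i => χ (X i ω)
  have mono : ∀ χ : ℝ → ℝ, Monotone χ → Monotone fun v : s → ℝ => ∑ i, χ (v i) :=
    fun χ hχ v w hvw => Finset.sum_le_sum fun i _ => hχ (hvw i)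
  have meas : ∀ χ : ℝ → ℝ, Monotone χ → Measurable fun v : s → ℝ => ∑ i, χ (v i) :=
    fun χ hχ => Finset.measurable_sum _ fun i _ => hχ.measurable.comp (measurable_pi_apply i)
  have key := hX s (fun v => ∑ i, φ (v i)) (fun v => ∑ i, ψ (v i)) (mono φ hφ) (mono ψ hψ)
    (meas φ hφ) (meas ψ hψ)
  simp only [e] at key
  rw [covariance_eq_sub h1 h2]
  exact key (h1.integrable one_le_two) (h2.integrable one_le_two) (h1.integrable_mul h2)

theorem StrictStationary.map_pair_eq {μ : Measure Ω} {X : ℕ → Ω → ℝ}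
    (hstat : StrictStationary μ X) (hmeas : ∀ j, Measurable (X j)) (k d : ℕ) :
    μ.map (fun ω => (X (1 + k) ω, X (1 + d + k) ω)) = μ.map (fun ω => (X 1 ω, X (1 + d) ω)) := by
  have h := congrArg (Measure.map fun v : Fin (d + 1) → ℝ => (v 0, v (Fin.last d)))
    (hstat k (d + 1))
  rw [Measure.map_map (by fun_prop) (measurable_pi_lambda _ fun i => hmeas _),
    Measure.map_map (by fun_prop) (measurable_pi_lambda _ fun i => hmeas _)] at h
  simpa [Function.comp_def] using h

theorem StrictStationary.map_eq {μ : Measure Ω} {X : ℕ → Ω → ℝ}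
    (hstat : StrictStationary μ X) (hmeas : ∀ j, Measurable (X j)) {i : ℕ} (hi : 1 ≤ i) :
    μ.map (X i) = μ.map (X 1) := by
  obtain ⟨k, rfl⟩ := Nat.exists_eq_add_of_le hi
  have h := congrArg (Measure.map Prod.fst) (hstat.map_pair_eq hmeas k 0)
  rw [Measure.map_map measurable_fst ((hmeas _).prodMk (hmeas _)),
    Measure.map_map measurable_fst ((hmeas _).prodMk (hmeas _))] at h
  exact h

theorem StrictStationary.covariance_eq {μ : Measure Ω} {X : ℕ → Ω → ℝ}
    (hstat : StrictStationary μ X) (hmeas : ∀ j, Measurable (X j)) (k d : ℕ) :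
    cov[X (1 + k), X (1 + d + k); μ] = cov[X 1, X (1 + d); μ] := by
  have e : ∀ i j, cov[X i, X j; μ] =
      cov[Prod.fst, Prod.snd; μ.map fun ω => (X i ω, X j ω)] := fun i j =>
    (covariance_map (Z := fun ω => (X i ω, X j ω)) measurable_fst.aestronglyMeasurable
      measurable_snd.aestronglyMeasurable ((hmeas i).prodMk (hmeas j)).aemeasurable).symm
  rw [e, e, hstat.map_pair_eq hmeas]

/-- The variance of the partial sums of a stationary sequence with summable covariances grows at
most linearly. -/
theorem StrictStationary.exists_variance_sum_le {μ : Measure Ω} [IsProbabilityMeasure μ]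
    {X : ℕ → Ω → ℝ} (hstat : StrictStationary μ X) (hmeas : ∀ j, Measurable (X j))
    (hL : ∀ i, 1 ≤ i → MemLp (X i) 2 μ) (hsum : Summable fun j : ℕ => cov μ (X 1) (X (j + 2))) :
    ∃ K : ℝ, 0 ≤ K ∧ ∀ n : ℕ, Var[fun ω => ∑ i ∈ Finset.Icc 1 n, X i ω; μ] ≤ K * n := by
  obtain ⟨T, hT⟩ := hsum.hasSum.tendsto_sum_nat.bddAbove_range
  have hT' : ∀ n, ∑ j ∈ Finset.range n, cov[X 1, X (j + 2); μ] ≤ T := fun n => by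
    refine le_trans (le_of_eq (Finset.sum_congr rfl fun j _ => ?_)) (hT ⟨n, rfl⟩)
    rw [covariance_eq_sub (hL 1 le_rfl) (hL _ (by omega))]
    rfl
  have hT0 : 0 ≤ T := by simpa using hT' 0
  refine ⟨2 * T + Var[X 1; μ], add_nonneg (by positivity) (variance_nonneg _ _), fun n => ?_⟩
  induction n with
  | zero =>
    refine le_of_eq ?_
    simp only [Finset.Icc_eq_empty_of_lt Nat.zero_lt_one, Finset.sum_empty, Nat.cast_zero, mul_zero]
    exact variance_zero μ
  | succ n ih =>
    have hS : MemLp (fun ω => ∑ i ∈ Finset.Icc 1 n, X i ω) 2 μ :=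
      memLp_finsetSum _ fun i hi => hL i (Finset.mem_Icc.mp hi).1
    have hsplit : (fun ω => ∑ i ∈ Finset.Icc 1 (n + 1), X i ω) =
        (fun ω => ∑ i ∈ Finset.Icc 1 n, X i ω) + X (n + 1) := by
      ext ω
      simp [Finset.sum_Icc_succ_top]
    have hvar : Var[X (n + 1); μ] = Var[X 1; μ] := by
      rw [← covariance_self (hmeas _).aemeasurable, ← covariance_self (hmeas _).aemeasurable]
      simpa [add_comm] using hstat.covariance_eq hmeas n 0
    have hcov : cov[fun ω => ∑ i ∈ Finset.Icc 1 n, X i ω, X (n + 1); μ] ≤ T := by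
      rw [covariance_fun_sum_left' (fun i hi => hL i (Finset.mem_Icc.mp hi).1) (hL _ (by omega))]
      refine le_trans (le_of_eq ?_) (hT' n)
      rw [← Finset.sum_range_reflect]
      rw [← Finset.Ico_succ_right_eq_Icc, Finset.sum_Ico_eq_sum_range]
      refine Finset.sum_congr (by simp) fun j hj => ?_
      have hj' : j < n := by simpa using hj
      have := hstat.covariance_eq hmeas j (n - j)
      rw [show 1 + (n - j) + j = n + 1 by omega,
        show 1 + (n - j) = n - 1 - j + 2 by omega] at this
      exact this
    rw [hsplit, variance_add hS (hL _ (by omega)), hvar]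
    push_cast
    linarith

/-- The centred sum `∑_{i=1}^n (|X_i - x| - ρ₁(x))`. -/
def devSum (μ : Measure Ω) (X : ℕ → Ω → ℝ) (n : ℕ) (ω : Ω) (x : ℝ) : ℝ :=
  ∑ i ∈ Finset.Icc 1 n, (|X i ω - x| - rho1 μ (X 1) x)

theorem rho1_eq_integral {μ : Measure Ω} {X : ℕ → Ω → ℝ} (hstat : StrictStationary μ X)
    (hmeas : ∀ j, Measurable (X j)) {i : ℕ} (hi : 1 ≤ i) (x : ℝ) :
    rho1 μ (X 1) x = ∫ ω, |X i ω - x| ∂μ := by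
  rw [rho1, ← hstat.map_eq hmeas hi, integral_map (hmeas i).aemeasurable (by fun_prop)]
  simp_rw [abs_sub_comm]

theorem monotone_abs_sub_sub_abs_sub {a b : ℝ} (hab : a ≤ b) :
    Monotone fun u : ℝ => |u - a| - |u - b| := by
  intro u v huv
  dsimp only
  rcases abs_cases (u - a) with h1 | h1 <;> rcases abs_cases (u - b) with h2 | h2 <;>
  rcases abs_cases (v - a) with h3 | h3 <;> rcases abs_cases (v - b) with h4 | h4 <;> linarith

section Bounded

variable {μ : Measure Ω} [IsProbabilityMeasure μ] {X : ℕ → Ω → ℝ} {C : ℝ}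

theorem devSum_eq_sub_integral (hstat : StrictStationary μ X) (hmeas : ∀ j, Measurable (X j))
    (hbdd : ∀ n : ℕ, 1 ≤ n → ∀ ω, |X n ω| ≤ C) (n : ℕ) (ω : Ω) (x : ℝ) :
    devSum μ X n ω x =
      ∑ i ∈ Finset.Icc 1 n, |X i ω - x| - ∫ ω', ∑ i ∈ Finset.Icc 1 n, |X i ω' - x| ∂μ := by
  rw [devSum, Finset.sum_sub_distrib, integral_finsetSum]
  · congr 1
    exact Finset.sum_congr rfl fun i hi => rho1_eq_integral hstat hmeas (Finset.mem_Icc.mp hi).1 x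
  · exact fun i hi => (memLp_comp_of_abs_le (hmeas i) (hbdd i (Finset.mem_Icc.mp hi).1)
      (f := fun u => |u - x|) (by fun_prop) 1).integrable le_rfl

theorem memLp_devSum (hmeas : ∀ j, Measurable (X j))
    (hbdd : ∀ n : ℕ, 1 ≤ n → ∀ ω, |X n ω| ≤ C) (n : ℕ) (x : ℝ) :
    MemLp (fun ω => devSum μ X n ω x) 2 μ :=
  memLp_finsetSum _ fun i hi => memLp_comp_of_abs_le (hmeas i)
    (hbdd i (Finset.mem_Icc.mp hi).1) (f := fun u => |u - x| - rho1 μ (X 1) x) (by fun_prop) 2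

theorem memLp_sum_comp (hmeas : ∀ j, Measurable (X j))
    (hbdd : ∀ n : ℕ, 1 ≤ n → ∀ ω, |X n ω| ≤ C) (n : ℕ) {f : ℝ → ℝ} (hf : Continuous f) :
    MemLp (fun ω => ∑ i ∈ Finset.Icc 1 n, f (X i ω)) 2 μ :=
  memLp_finsetSum _ fun i hi => memLp_comp_of_abs_le (hmeas i)
    (hbdd i (Finset.mem_Icc.mp hi).1) hf 2

theorem integral_devSum_sub_sq (hstat : StrictStationary μ X) (hmeas : ∀ j, Measurable (X j))
    (hbdd : ∀ n : ℕ, 1 ≤ n → ∀ ω, |X n ω| ≤ C) (n : ℕ) (a b : ℝ) :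
    ∫ ω, (devSum μ X n ω b - devSum μ X n ω a) ^ 2 ∂μ =
      Var[fun ω => ∑ i ∈ Finset.Icc 1 n, (|X i ω - a| - |X i ω - b|); μ] := by
  have hI : ∀ x : ℝ, Integrable (fun ω => ∑ i ∈ Finset.Icc 1 n, |X i ω - x|) μ := fun x =>
    (memLp_sum_comp hmeas hbdd n (f := fun u => |u - x|) (by fun_prop)).integrable one_le_two
  rw [variance_eq_integral (memLp_sum_comp hmeas hbdd n
    (f := fun u => |u - a| - |u - b|) (by fun_prop)).aemeasurable]
  refine integral_congr_ae (ae_of_all _ fun ω => ?_)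
  simp only [devSum_eq_sub_integral hstat hmeas hbdd, Finset.sum_sub_distrib]
  rw [integral_sub (hI a) (hI b)]
  ring

theorem integral_devSum_neg_sq (hstat : StrictStationary μ X) (hmeas : ∀ j, Measurable (X j))
    (hbdd : ∀ n : ℕ, 1 ≤ n → ∀ ω, |X n ω| ≤ C) (n : ℕ) :
    ∫ ω, devSum μ X n ω (-C) ^ 2 ∂μ = Var[fun ω => ∑ i ∈ Finset.Icc 1 n, X i ω; μ] := by
  have habs : ∀ ω, ∑ i ∈ Finset.Icc 1 n, |X i ω - -C| = ∑ i ∈ Finset.Icc 1 n, X i ω + n * C := by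
    intro ω
    have : ∀ i ∈ Finset.Icc 1 n, |X i ω - -C| = X i ω + C := fun i hi => by
      have := abs_le.mp (hbdd i (Finset.mem_Icc.mp hi).1 ω)
      rw [abs_of_nonneg] <;> linarith
    rw [Finset.sum_congr rfl this, Finset.sum_add_distrib]
    simp
  have hL := memLp_sum_comp (μ := μ) hmeas hbdd n (f := fun u => u) (by fun_prop)
  rw [variance_eq_integral hL.aemeasurable]
  refine integral_congr_ae (ae_of_all _ fun ω => ?_)
  simp only [devSum_eq_sub_integral hstat hmeas hbdd, habs]
  rw [integral_add (hL.integrable one_le_two) (integrable_const _)]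
  simp

/-- Along an increasing grid of `[-C, C]`, the increments of the centred sums have total second
moment controlled by the variance of the partial sums. -/
theorem sum_integral_devSum_sub_sq_le (hstat : StrictStationary μ X)
    (hassoc : IsAssociated μ X) (hmeas : ∀ j, Measurable (X j))
    (hbdd : ∀ n : ℕ, 1 ≤ n → ∀ ω, |X n ω| ≤ C) (n N : ℕ) {t : ℕ → ℝ} (ht : Monotone t)
    (ht0 : t 0 = -C) (htN : t N = C) :
    ∑ k ∈ Finset.range N, ∫ ω, (devSum μ X n ω (t (k + 1)) - devSum μ X n ω (t k)) ^ 2 ∂μ ≤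
      4 * Var[fun ω => ∑ i ∈ Finset.Icc 1 n, X i ω; μ] := by
  set U : ℕ → Ω → ℝ := fun k ω =>
    ∑ i ∈ Finset.Icc 1 n, (|X i ω - t k| - |X i ω - t (k + 1)|) with hU
  have hUL : ∀ k, MemLp (U k) 2 μ := fun k => memLp_sum_comp hmeas hbdd n
    (f := fun u => |u - t k| - |u - t (k + 1)|) (by fun_prop)
  have hcov : ∀ k l, 0 ≤ cov[U k, U l; μ] := fun k l =>
    hassoc.covariance_sum_nonneg _ (monotone_abs_sub_sub_abs_sub (ht k.le_succ))
      (monotone_abs_sub_sub_abs_sub (ht l.le_succ))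
      (fun i hi => memLp_comp_of_abs_le (hmeas i) (hbdd i (Finset.mem_Icc.mp hi).1)
        (f := fun u => |u - t k| - |u - t (k + 1)|) (by fun_prop) 2)
      (fun i hi => memLp_comp_of_abs_le (hmeas i) (hbdd i (Finset.mem_Icc.mp hi).1)
        (f := fun u => |u - t l| - |u - t (l + 1)|) (by fun_prop) 2)
  have htel : (fun ω => ∑ k ∈ Finset.range N, U k ω) =
      fun ω => 2 * ∑ i ∈ Finset.Icc 1 n, X i ω := by
    ext ω
    rw [Finset.sum_comm, Finset.mul_sum]
    refine Finset.sum_congr rfl fun i hi => ?_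
    rw [Finset.sum_range_sub', ht0, htN]
    have := abs_le.mp (hbdd i (Finset.mem_Icc.mp hi).1 ω)
    rw [abs_of_nonneg (by linarith), abs_of_nonpos (by linarith)]
    ring
  calc ∑ k ∈ Finset.range N, ∫ ω, (devSum μ X n ω (t (k + 1)) - devSum μ X n ω (t k)) ^ 2 ∂μ
      = ∑ k ∈ Finset.range N, cov[U k, U k; μ] := Finset.sum_congr rfl fun k _ => by
        rw [integral_devSum_sub_sq hstat hmeas hbdd, covariance_self (hUL k).aemeasurable]
    _ ≤ ∑ k ∈ Finset.range N, ∑ l ∈ Finset.range N, cov[U k, U l; μ] :=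
        Finset.sum_le_sum fun k hk => Finset.single_le_sum (fun l _ => hcov k l) hk
    _ = cov[fun ω => ∑ k ∈ Finset.range N, U k ω, fun ω => ∑ k ∈ Finset.range N, U k ω; μ] :=
        (covariance_fun_sum_fun_sum' (fun k _ => hUL k) fun k _ => hUL k).symm
    _ = 4 * Var[fun ω => ∑ i ∈ Finset.Icc 1 n, X i ω; μ] := by
        rw [htel, covariance_const_mul_left, covariance_const_mul_right, covariance_self
          (memLp_sum_comp (μ := μ) hmeas hbdd n (f := fun u => u) (by fun_prop)).aemeasurable]
        ring

end Bounded

/-- Dyadic chaining: a function is controlled on the `M`-th level of a nested family of grids by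
its increments on all the levels up to `M`. -/
theorem abs_le_add_sum_sqrt_of_dyadic (g : ℝ → ℝ) {t : ℕ → ℕ → ℝ}
    (ht : ∀ m k, t (m + 1) (2 * k) = t m k) (M : ℕ) :
    ∀ k ≤ 2 ^ M, |g (t M k)| ≤ |g (t 0 0)| + ∑ m ∈ Finset.range (M + 1),
      √(∑ k ∈ Finset.range (2 ^ m), (g (t m (k + 1)) - g (t m k)) ^ 2) := by
  have step : ∀ m k, k < 2 ^ m → |g (t m (k + 1))| ≤ |g (t m k)| +
      √(∑ k ∈ Finset.range (2 ^ m), (g (t m (k + 1)) - g (t m k)) ^ 2) := fun m k hk => by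
    have h1 : |g (t m (k + 1)) - g (t m k)| ≤
        √(∑ k ∈ Finset.range (2 ^ m), (g (t m (k + 1)) - g (t m k)) ^ 2) :=
      Real.abs_le_sqrt (Finset.single_le_sum
        (f := fun k => (g (t m (k + 1)) - g (t m k)) ^ 2) (fun _ _ => sq_nonneg _)
        (Finset.mem_range.mpr hk))
    have h2 := abs_sub_abs_le_abs_sub (g (t m (k + 1))) (g (t m k))
    linarith
  induction M with
  | zero =>
    intro k hk
    rw [zero_add, Finset.sum_range_one]
    obtain rfl | rfl : k = 0 ∨ k = 1 := by
      rw [pow_zero] at hk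
      omega
    · exact le_add_of_nonneg_right (Real.sqrt_nonneg _)
    · exact step 0 0 (by simp)
  | succ M ih =>
    intro k hk
    rw [pow_succ] at hk
    rw [Finset.sum_range_succ, ← add_assoc]
    obtain ⟨j, rfl | rfl⟩ := Nat.even_or_odd' k
    · rw [ht]
      exact (ih j (by omega)).trans (le_add_of_nonneg_right (Real.sqrt_nonneg _))
    · refine (step (M + 1) (2 * j) (by rw [pow_succ]; omega)).trans ?_
      rw [ht]
      exact add_le_add_left (ih j (by omega)) _

theorem sq_le_mul_of_dyadic (g : ℝ → ℝ) {t : ℕ → ℕ → ℝ}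
    (ht : ∀ m k, t (m + 1) (2 * k) = t m k) (M : ℕ) {k : ℕ} (hk : k ≤ 2 ^ M) :
    g (t M k) ^ 2 ≤ (M + 2) * (g (t 0 0) ^ 2 + ∑ m ∈ Finset.range (M + 1),
      ∑ k ∈ Finset.range (2 ^ m), (g (t m (k + 1)) - g (t m k)) ^ 2) := by
  set V : ℕ → ℝ := fun m => ∑ k ∈ Finset.range (2 ^ m), (g (t m (k + 1)) - g (t m k)) ^ 2 with hV
  have hV0 : ∀ m, 0 ≤ V m := fun m => Finset.sum_nonneg fun _ _ => sq_nonneg _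
  set f : ℕ → ℝ := fun m => Nat.casesOn m |g (t 0 0)| fun m => √(V m) with hf
  have h1 : |g (t M k)| ≤ ∑ m ∈ Finset.range (M + 2), f m := by
    rw [Finset.sum_range_succ', add_comm]
    exact abs_le_add_sum_sqrt_of_dyadic g ht M k hk
  have h2 : ∑ m ∈ Finset.range (M + 2), f m ^ 2 =
      g (t 0 0) ^ 2 + ∑ m ∈ Finset.range (M + 1), V m := by
    rw [Finset.sum_range_succ', add_comm]
    simp only [hf, Real.sq_sqrt (hV0 _)]
    exact congrArg (· + _) (sq_abs _)
  have h3 := sq_sum_le_card_mul_sum_sq (s := Finset.range (M + 2)) (f := f)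
  rw [h2, Finset.card_range] at h3
  push_cast at h3
  rw [← sq_abs]
  exact (pow_le_pow_left₀ (abs_nonneg _) h1 2).trans h3

/-- The `k`-th point of the dyadic grid of `[-C, C]` with mesh `2C / 2^m`. -/
def dyadicPoint (C : ℝ) (m k : ℕ) : ℝ := -C + 2 * C * (k / 2 ^ m)

theorem dyadicPoint_succ_two_mul (C : ℝ) (m k : ℕ) :
    dyadicPoint C (m + 1) (2 * k) = dyadicPoint C m k := by
  unfold dyadicPoint
  push_cast
  rw [pow_succ]
  field_simp

theorem exists_dyadicPoint_close {C : ℝ} (hC : 0 ≤ C) (m : ℕ) {x : ℝ} (hx : |x| ≤ C) :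
    ∃ k ≤ 2 ^ m, |x - dyadicPoint C m k| ≤ 2 * C / 2 ^ m := by
  rcases hC.eq_or_lt with rfl | hC
  · exact ⟨0, Nat.zero_le _, by simp [dyadicPoint, abs_nonpos_iff.mp hx]⟩
  obtain ⟨h1, h2⟩ := abs_le.mp hx
  have hp : (0 : ℝ) < 2 ^ m := by positivity
  set y : ℝ := (x + C) / (2 * C) * 2 ^ m with hy
  have hy0 : 0 ≤ y := by
    have : 0 ≤ x + C := by linarith
    positivity
  have hxy : x = -C + 2 * C * (y / 2 ^ m) := by
    rw [hy]
    field_simp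
    ring
  have hle := Nat.floor_le hy0
  have hlt := Nat.lt_floor_add_one y
  refine ⟨⌊y⌋₊, ?_, ?_⟩
  · have : y ≤ 2 ^ m := mul_le_of_le_one_left hp.le ((div_le_one (by positivity)).mpr (by linarith))
    exact_mod_cast hle.trans this
  · have e : x - dyadicPoint C m ⌊y⌋₊ = 2 * C / 2 ^ m * (y - ⌊y⌋₊) := by
      conv_lhs => rw [hxy, dyadicPoint]
      ring
    rw [e, abs_of_nonneg (mul_nonneg (by positivity) (by linarith))]
    exact mul_le_of_le_one_right (by positivity) (by linarith)

/-- The sum of the squared increments of the centred sums over the first `M + 1` dyadic grids. -/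
def chainSum (μ : Measure Ω) (X : ℕ → Ω → ℝ) (C : ℝ) (n M : ℕ) (ω : Ω) : ℝ :=
  devSum μ X n ω (dyadicPoint C 0 0) ^ 2 + ∑ m ∈ Finset.range (M + 1),
    ∑ k ∈ Finset.range (2 ^ m),
      (devSum μ X n ω (dyadicPoint C m (k + 1)) - devSum μ X n ω (dyadicPoint C m k)) ^ 2

theorem chainSum_nonneg (μ : Measure Ω) (X : ℕ → Ω → ℝ) (C : ℝ) (n M : ℕ) (ω : Ω) :
    0 ≤ chainSum μ X C n M ω := by
  unfold chainSum
  positivity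

section Bounded

variable {μ : Measure Ω} [IsProbabilityMeasure μ] {X : ℕ → Ω → ℝ} {C : ℝ}

theorem integrable_devSum_sub_sq (hmeas : ∀ j, Measurable (X j))
    (hbdd : ∀ n : ℕ, 1 ≤ n → ∀ ω, |X n ω| ≤ C) (n : ℕ) (a b : ℝ) :
    Integrable (fun ω => (devSum μ X n ω b - devSum μ X n ω a) ^ 2) μ :=
  ((memLp_devSum hmeas hbdd n b).sub (memLp_devSum hmeas hbdd n a)).integrable_sq

theorem integrable_chainSum (hmeas : ∀ j, Measurable (X j))
    (hbdd : ∀ n : ℕ, 1 ≤ n → ∀ ω, |X n ω| ≤ C) (n M : ℕ) :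
    Integrable (chainSum μ X C n M) μ :=
  (memLp_devSum hmeas hbdd n _).integrable_sq.add <| integrable_finsetSum _ fun _ _ =>
    integrable_finsetSum _ fun _ _ => integrable_devSum_sub_sq hmeas hbdd n _ _

theorem integral_chainSum_le (hstat : StrictStationary μ X)
    (hassoc : IsAssociated μ X) (hmeas : ∀ j, Measurable (X j)) (hC : 0 ≤ C)
    (hbdd : ∀ n : ℕ, 1 ≤ n → ∀ ω, |X n ω| ≤ C) (n M : ℕ) :
    ∫ ω, chainSum μ X C n M ω ∂μ ≤
      4 * (M + 2) * Var[fun ω => ∑ i ∈ Finset.Icc 1 n, X i ω; μ] := by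
  have hI := fun m k => integrable_devSum_sub_sq (μ := μ) hmeas hbdd n
    (dyadicPoint C m k) (dyadicPoint C m (k + 1))
  unfold chainSum
  rw [integral_add (memLp_devSum hmeas hbdd n _).integrable_sq
    (integrable_finsetSum _ fun m _ => integrable_finsetSum _ fun k _ => hI m k),
    integral_finsetSum _ fun m _ => integrable_finsetSum _ fun k _ => hI m k]
  have h0 : dyadicPoint C 0 0 = -C := by simp [dyadicPoint]
  rw [h0, integral_devSum_neg_sq hstat hmeas hbdd]
  have hlevel : ∀ m ∈ Finset.range (M + 1),
      ∫ ω, ∑ k ∈ Finset.range (2 ^ m), (devSum μ X n ω (dyadicPoint C m (k + 1)) -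
        devSum μ X n ω (dyadicPoint C m k)) ^ 2 ∂μ ≤
      4 * Var[fun ω => ∑ i ∈ Finset.Icc 1 n, X i ω; μ] := fun m _ => by
    rw [integral_finsetSum _ fun k _ => hI m k]
    refine sum_integral_devSum_sub_sq_le hstat hassoc hmeas hbdd n (2 ^ m) ?_ ?_ ?_
    · intro k l hkl
      unfold dyadicPoint
      gcongr
    · simp [dyadicPoint]
    · simp [dyadicPoint]
      ring
  have h1 := Finset.sum_le_card_nsmul _ _ _ hlevel
  rw [Finset.card_range, nsmul_eq_mul] at h1
  push_cast at h1
  nlinarith [variance_nonneg (fun ω => ∑ i ∈ Finset.Icc 1 n, X i ω) μ]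

theorem abs_devSum_sub_le (hmeas : ∀ j, Measurable (X j))
    (hbdd : ∀ n : ℕ, 1 ≤ n → ∀ ω, |X n ω| ≤ C) (n : ℕ) (ω : Ω) (x y : ℝ) :
    |devSum μ X n ω x - devSum μ X n ω y| ≤ n * (2 * |x - y|) := by
  have hlip : ∀ u : ℝ, |(|u - x| - |u - y|)| ≤ |x - y| := fun u => by
    have := abs_abs_sub_abs_le_abs_sub (u - x) (u - y)
    rwa [sub_sub_sub_cancel_left, abs_sub_comm y x] at this
  have hI : ∀ z : ℝ, Integrable (fun u => |z - u|) (μ.map (X 1)) := fun z => by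
    rw [integrable_map_measure (by fun_prop) (hmeas 1).aemeasurable]
    exact (memLp_comp_of_abs_le (hmeas 1) (hbdd 1 le_rfl) (f := fun u => |z - u|)
      (by fun_prop) 1).integrable le_rfl
  have hrho : |rho1 μ (X 1) x - rho1 μ (X 1) y| ≤ |x - y| := by
    have : IsProbabilityMeasure (μ.map (X 1)) :=
      Measure.isProbabilityMeasure_map (hmeas 1).aemeasurable
    rw [rho1, rho1, ← integral_sub (hI x) (hI y)]
    have := norm_integral_le_of_norm_le_const (μ := μ.map (X 1)) (C := |x - y|)
      (f := fun u => |x - u| - |y - u|) (ae_of_all _ fun u => by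
        simpa [abs_sub_comm x u, abs_sub_comm y u] using hlip u)
    simpa using this
  rw [devSum, devSum, ← Finset.sum_sub_distrib]
  refine (Finset.abs_sum_le_sum_abs _ _).trans ?_
  refine (Finset.sum_le_card_nsmul _ _ (2 * |x - y|) fun i _ => ?_).trans (by simp)
  have h := abs_le.mp (hlip (X i ω))
  have h' := abs_le.mp hrho
  rw [abs_le]
  constructor <;> linarith

theorem abs_devSum_le_add (hmeas : ∀ j, Measurable (X j))
    (hbdd : ∀ n : ℕ, 1 ≤ n → ∀ ω, |X n ω| ≤ C) (hstat : StrictStationary μ X)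
    {n n' : ℕ} (hn : n' ≤ n) (ω : Ω) {x : ℝ} (hx : |x| ≤ C) :
    |devSum μ X n ω x| ≤ |devSum μ X n' ω x| + 2 * C * (n - n') := by
  have hrange : ∀ i, 1 ≤ i → ∀ ω, |X i ω - x| ≤ 2 * C := fun i hi ω =>
    (abs_sub _ _).trans (by linarith [hbdd i hi ω])
  have hrho0 : 0 ≤ rho1 μ (X 1) x := integral_nonneg fun _ => abs_nonneg _
  have hrho : rho1 μ (X 1) x ≤ 2 * C := by
    rw [rho1_eq_integral hstat hmeas le_rfl]
    have := norm_integral_le_of_norm_le_const (μ := μ) (C := 2 * C)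
      (f := fun ω => |X 1 ω - x|) (ae_of_all _ fun ω => by simpa using hrange 1 le_rfl ω)
    simpa using (le_abs_self _).trans this
  induction n, hn using Nat.le_induction with
  | base => simp
  | succ n hn ih =>
    rw [devSum, Finset.sum_Icc_succ_top (by omega), ← devSum]
    have h1 : |(|X (n + 1) ω - x| - rho1 μ (X 1) x)| ≤ 2 * C := by
      rw [abs_le]
      have := hrange (n + 1) (by omega) ω
      have := abs_nonneg (X (n + 1) ω - x)
      constructor <;> linarith
    have h2 := abs_add_le (devSum μ X n ω x) (|X (n + 1) ω - x| - rho1 μ (X 1) x)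
    push_cast
    linarith

theorem abs_devSum_le_sqrt_add (hmeas : ∀ j, Measurable (X j)) (hC : 0 ≤ C)
    (hbdd : ∀ n : ℕ, 1 ≤ n → ∀ ω, |X n ω| ≤ C) (n M : ℕ) (ω : Ω) {x : ℝ} (hx : |x| ≤ C) :
    |devSum μ X n ω x| ≤ √((M + 2) * chainSum μ X C n M ω) + n * (4 * C / 2 ^ M) := by
  obtain ⟨k, hk, hxk⟩ := exists_dyadicPoint_close hC M hx
  have h1 := Real.abs_le_sqrt
    (sq_le_mul_of_dyadic (devSum μ X n ω) (dyadicPoint_succ_two_mul C) M hk)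
  have h2 := abs_devSum_sub_le (μ := μ) hmeas hbdd n ω x (dyadicPoint C M k)
  have h3 := abs_sub_abs_le_abs_sub (devSum μ X n ω x) (devSum μ X n ω (dyadicPoint C M k))
  have h4 : (n : ℝ) * (2 * |x - dyadicPoint C M k|) ≤ n * (4 * C / 2 ^ M) := by
    refine mul_le_mul_of_nonneg_left ?_ (Nat.cast_nonneg n)
    calc 2 * |x - dyadicPoint C M k| ≤ 2 * (2 * C / 2 ^ M) := by linarith
      _ = 4 * C / 2 ^ M := by ring
  exact (by linarith : _ ≤ _ + _).trans (add_le_add_left h1 _)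

end Bounded

theorem ae_tendsto_zero_of_summable_integral {μ : Measure Ω} {Z : ℕ → Ω → ℝ}
    (hZ : ∀ k, Integrable (Z k) μ) (hZ0 : ∀ k ω, 0 ≤ Z k ω)
    (hsum : Summable fun k => ∫ ω, Z k ω ∂μ) :
    ∀ᵐ ω ∂μ, Tendsto (fun k => Z k ω) atTop (𝓝 0) := by
  have hfin : ∫⁻ ω, ∑' k, ENNReal.ofReal (Z k ω) ∂μ ≠ ⊤ := by
    rw [lintegral_tsum fun k => (hZ k).aestronglyMeasurable.aemeasurable.ennreal_ofReal]
    simp_rw [← ofReal_integral_eq_lintegral_ofReal (hZ _) (ae_of_all _ (hZ0 _))]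
    rw [← ENNReal.ofReal_tsum_of_nonneg (fun k => integral_nonneg (hZ0 k)) hsum]
    exact ENNReal.ofReal_ne_top
  filter_upwards [ae_lt_top' (AEMeasurable.tsum fun k =>
    (hZ k).aestronglyMeasurable.aemeasurable.ennreal_ofReal) hfin] with ω hω
  have h := (ENNReal.tendsto_toReal ENNReal.zero_ne_top).comp
    (ENNReal.tendsto_atTop_zero_of_tsum_ne_top hω.ne)
  simpa [Function.comp_def, ENNReal.toReal_ofReal (hZ0 _ ω)] using h

theorem summable_rpow_mul_natLog_sq :
    Summable fun k : ℕ => (k : ℝ) ^ (-(6 / 5) : ℝ) * ((Nat.log 2 k : ℝ) + 3) ^ 2 := by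
  have hs : Summable fun k : ℕ => 43 ^ 2 * (k : ℝ) ^ (-(11 / 10) : ℝ) :=
    (Real.summable_nat_rpow.mpr (by norm_num)).mul_left _
  refine hs.of_nonneg_of_le (fun k => by positivity) fun k => ?_
  rcases k.eq_zero_or_pos with rfl | hk
  · norm_num [Real.zero_rpow]
  have hk1 : (1 : ℝ) ≤ k := by exact_mod_cast hk
  have hk0 : (0 : ℝ) < k := by linarith
  have h1 : (Nat.log 2 k : ℝ) ≤ 40 * (k : ℝ) ^ (1 / 20 : ℝ) := by
    have hl2 : (1 / 2 : ℝ) ≤ Real.log 2 := by linarith [Real.log_two_gt_d9]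
    have hlog : Real.log k ≤ (k : ℝ) ^ (1 / 20 : ℝ) / (1 / 20) :=
      Real.log_le_rpow_div hk0.le (by norm_num)
    have hlogb : (Nat.log 2 k : ℝ) ≤ Real.log k / Real.log 2 := Real.natLog_le_logb k 2
    rw [le_div_iff₀ (by linarith)] at hlogb
    nlinarith [Nat.cast_nonneg (α := ℝ) (Nat.log 2 k)]
  have h2 : (1 : ℝ) ≤ (k : ℝ) ^ (1 / 20 : ℝ) := Real.one_le_rpow hk1 (by norm_num)
  calc (k : ℝ) ^ (-(6 / 5) : ℝ) * ((Nat.log 2 k : ℝ) + 3) ^ 2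
      ≤ (k : ℝ) ^ (-(6 / 5) : ℝ) * (43 * (k : ℝ) ^ (1 / 20 : ℝ)) ^ 2 := by
        gcongr
        linarith
    _ = 43 ^ 2 * ((k : ℝ) ^ (-(6 / 5) : ℝ) *
          ((k : ℝ) ^ (1 / 20 : ℝ) * (k : ℝ) ^ (1 / 20 : ℝ))) := by ring
    _ = 43 ^ 2 * (k : ℝ) ^ (-(11 / 10) : ℝ) := by
        rw [← Real.rpow_add hk0, ← Real.rpow_add hk0]
        norm_num

theorem blockLen_le_self {n : ℕ} (hn : 1 ≤ n) : blockLen n ≤ n := by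
  refine Nat.floor_le_of_le ?_
  exact Real.rpow_le_self_of_one_le (by exact_mod_cast hn) (by norm_num)

theorem sqrt_blockLen_le (n : ℕ) : √(blockLen n : ℝ) ≤ (n : ℝ) ^ (3 / 10 : ℝ) := by
  refine Real.sqrt_le_iff.mpr ⟨by positivity, (Nat.floor_le (by positivity)).trans_eq ?_⟩
  rw [← Real.rpow_natCast, ← Real.rpow_mul (Nat.cast_nonneg n)]
  norm_num

/-- The block statistic is Lipschitz, with constant `2 √ℓ`, for the uniform norm of its
arguments. -/
theorem abs_Bgen_sub_Bgen_le {α : Type*} (Y Y' : ℕ → ℕ → α → ℝ) {n : ℕ} (hn : 1 ≤ n) (ω : α) {δ : ℝ}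
    (hδ : ∀ i ∈ Finset.Icc 1 n, |Y n i ω - Y' n i ω| ≤ δ) :
    |Bgen Y n ω - Bgen Y' n ω| ≤ 2 * √(blockLen n : ℝ) * δ := by
  have hl := blockLen_le_self hn
  have hn0 : (0 : ℝ) < n := by exact_mod_cast hn
  have hN : (n : ℝ) - blockLen n + 1 = ((n - blockLen n + 1 : ℕ) : ℝ) := by
    push_cast [Nat.cast_sub hl]
    ring
  have hsumdiff : ∀ s ⊆ Finset.Icc 1 n,
      |∑ i ∈ s, Y n i ω - ∑ i ∈ s, Y' n i ω| ≤ s.card * δ := fun s hs => by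
    rw [← Finset.sum_sub_distrib, ← nsmul_eq_mul]
    exact (Finset.abs_sum_le_sum_abs _ _).trans
      (Finset.sum_le_card_nsmul _ _ _ fun i hi => hδ i (hs hi))
  have hterm : ∀ j ∈ Finset.range (n - blockLen n + 1),
      |(|(∑ i ∈ Finset.Icc (j + 1) (j + blockLen n), Y n i ω) -
          (blockLen n : ℝ) * ((1 / (n : ℝ)) * ∑ i ∈ Finset.Icc 1 n, Y n i ω)| /
          √(blockLen n : ℝ) -
        |(∑ i ∈ Finset.Icc (j + 1) (j + blockLen n), Y' n i ω) -
          (blockLen n : ℝ) * ((1 / (n : ℝ)) * ∑ i ∈ Finset.Icc 1 n, Y' n i ω)| /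
          √(blockLen n : ℝ))| ≤ 2 * √(blockLen n : ℝ) * δ := fun j hj => by
    rw [Finset.mem_range] at hj
    have h1 := hsumdiff (Finset.Icc (j + 1) (j + blockLen n))
      (Finset.Icc_subset_Icc (by omega) (by omega))
    have h2 := hsumdiff (Finset.Icc 1 n) subset_rfl
    rw [Nat.card_Icc, show j + blockLen n + 1 - (j + 1) = blockLen n by omega] at h1
    rw [Nat.card_Icc, Nat.add_sub_cancel] at h2
    have h3 : |(1 / (n : ℝ)) * (∑ i ∈ Finset.Icc 1 n, Y n i ω - ∑ i ∈ Finset.Icc 1 n, Y' n i ω)|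
        ≤ δ := by
      rw [abs_mul, abs_of_pos (by positivity), one_div, inv_mul_le_iff₀ hn0]
      exact h2
    rw [← sub_div, abs_div, abs_of_nonneg (Real.sqrt_nonneg _)]
    have h4 : 2 * √(blockLen n : ℝ) * δ = 2 * (blockLen n : ℝ) * δ / √(blockLen n : ℝ) := by
      rw [mul_div_right_comm, mul_div_assoc, Real.div_sqrt]
    rw [h4]
    refine div_le_div_of_nonneg_right ((abs_abs_sub_abs_le_abs_sub _ _).trans ?_)
      (Real.sqrt_nonneg _)
    have h5 := mul_le_mul_of_nonneg_left h3 (Nat.cast_nonneg (α := ℝ) (blockLen n))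
    rw [← abs_of_nonneg (Nat.cast_nonneg (α := ℝ) (blockLen n)), ← abs_mul,
      abs_of_nonneg (Nat.cast_nonneg (α := ℝ) (blockLen n))] at h5
    refine le_trans (le_of_eq ?_) ((abs_sub _ _).trans ((add_le_add h1 h5).trans_eq (by ring)))
    congr 1
    ring
  unfold Bgen
  rw [hN, ← mul_sub, ← Finset.sum_sub_distrib, abs_mul, abs_of_nonneg (by positivity), one_div,
    inv_mul_le_iff₀ (by positivity)]
  refine (Finset.abs_sum_le_sum_abs _ _).trans ?_
  have h := Finset.sum_le_card_nsmul _ _ _ hterm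
  rwa [Finset.card_range, nsmul_eq_mul] at h

theorem rhoHat_sub_rho1 (μ : Measure Ω) (X : ℕ → Ω → ℝ) {n : ℕ} (hn : 1 ≤ n) (ω : Ω) (x : ℝ) :
    rhoHat X n ω x - rho1 μ (X 1) x = devSum μ X n ω x / n := by
  have hn0 : (n : ℝ) ≠ 0 := by positivity
  rw [rhoHat, devSum, Finset.sum_sub_distrib]
  simp
  field_simp

/-- The rescaled squared maximal deviation at time `k ^ 3`. -/
def cubeDev (μ : Measure Ω) (X : ℕ → Ω → ℝ) (C : ℝ) (k : ℕ) (ω : Ω) : ℝ :=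
  (k : ℝ) ^ (-(21 / 5) : ℝ) *
    (((Nat.log 2 k + 1 : ℕ) + 2) * chainSum μ X C (k ^ 3) (Nat.log 2 k + 1) ω)

theorem cubeDev_nonneg (μ : Measure Ω) (X : ℕ → Ω → ℝ) (C : ℝ) (k : ℕ) (ω : Ω) :
    0 ≤ cubeDev μ X C k ω :=
  mul_nonneg (by positivity) (mul_nonneg (by positivity) (chainSum_nonneg _ _ _ _ _ _))

section Bounded

variable {μ : Measure Ω} [IsProbabilityMeasure μ] {X : ℕ → Ω → ℝ} {C : ℝ}

theorem ae_tendsto_cubeDev (hstat : StrictStationary μ X)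
    (hassoc : IsAssociated μ X) (hmeas : ∀ j, Measurable (X j)) (hC : 0 ≤ C)
    (hbdd : ∀ n : ℕ, 1 ≤ n → ∀ ω, |X n ω| ≤ C)
    (hsum : Summable fun j : ℕ => cov μ (X 1) (X (j + 2))) :
    ∀ᵐ ω ∂μ, Tendsto (fun k => cubeDev μ X C k ω) atTop (𝓝 0) := by
  obtain ⟨K, hK, hvar⟩ := hstat.exists_variance_sum_le hmeas
    (fun i hi => memLp_comp_of_abs_le (hmeas i) (hbdd i hi) (f := fun u => u) (by fun_prop) 2) hsum
  refine ae_tendsto_zero_of_summable_integral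
    (fun k => ((integrable_chainSum hmeas hbdd _ _).const_mul _).const_mul _)
    (cubeDev_nonneg μ X C) ?_
  refine (summable_rpow_mul_natLog_sq.mul_left (4 * K)).of_nonneg_of_le
    (fun k => integral_nonneg (cubeDev_nonneg μ X C k)) fun k => ?_
  unfold cubeDev
  rw [integral_const_mul, integral_const_mul]
  rcases k.eq_zero_or_pos with rfl | hk
  · norm_num [Real.zero_rpow]
  have hk0 : (0 : ℝ) < k := by exact_mod_cast hk
  have h1 := (integral_chainSum_le hstat hassoc hmeas hC hbdd (k ^ 3) (Nat.log 2 k + 1)).trans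
    (mul_le_mul_of_nonneg_left (hvar (k ^ 3)) (by positivity))
  have h2 : (k : ℝ) ^ (-(21 / 5) : ℝ) * (k : ℝ) ^ 3 = (k : ℝ) ^ (-(6 / 5) : ℝ) := by
    rw [← Real.rpow_natCast, ← Real.rpow_add hk0]
    norm_num
  calc _ ≤ (k : ℝ) ^ (-(21 / 5) : ℝ) * (((Nat.log 2 k + 1 : ℕ) + 2) *
        (4 * ((Nat.log 2 k + 1 : ℕ) + 2) * (K * (k ^ 3 : ℕ)))) := by gcongr
    _ = 4 * K * (((k : ℝ) ^ (-(21 / 5) : ℝ) * (k : ℝ) ^ 3) * ((Nat.log 2 k : ℝ) + 3) ^ 2) := by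
        push_cast
        ring
    _ = _ := by rw [h2]

theorem abs_devSum_le_of_cube_le (hstat : StrictStationary μ X)
    (hmeas : ∀ j, Measurable (X j)) (hC : 0 ≤ C)
    (hbdd : ∀ n : ℕ, 1 ≤ n → ∀ ω, |X n ω| ≤ C) {n k : ℕ} (hk : 1 ≤ k) (hkn : k ^ 3 ≤ n)
    (hnk : n < (k + 1) ^ 3) (ω : Ω) {x : ℝ} (hx : |x| ≤ C) :
    (k : ℝ) ^ (-(21 / 10) : ℝ) * |devSum μ X n ω x| ≤
      √(cubeDev μ X C k ω) + 18 * C * (k : ℝ) ^ (-(1 / 10) : ℝ) := by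
  have hk1 : (1 : ℝ) ≤ k := by exact_mod_cast hk
  have hk0 : (0 : ℝ) < k := by linarith
  have h1 := abs_devSum_le_add hmeas hbdd hstat hkn ω hx
  have h2 := abs_devSum_le_sqrt_add (μ := μ) hmeas hC hbdd (k ^ 3) (Nat.log 2 k + 1) ω hx
  have h3 : (n : ℝ) - (k ^ 3 : ℕ) ≤ 7 * (k : ℝ) ^ 2 := by
    have : (n : ℝ) + 1 ≤ (k + 1) ^ 3 := by exact_mod_cast hnk
    push_cast
    nlinarith
  have h4 : ((k ^ 3 : ℕ) : ℝ) * (4 * C / 2 ^ (Nat.log 2 k + 1)) ≤ 4 * C * (k : ℝ) ^ 2 := by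
    have : (k : ℝ) ≤ 2 ^ (Nat.log 2 k + 1) := by
      exact_mod_cast (Nat.lt_pow_succ_log_self one_lt_two k).le
    calc ((k ^ 3 : ℕ) : ℝ) * (4 * C / 2 ^ (Nat.log 2 k + 1))
        ≤ ((k ^ 3 : ℕ) : ℝ) * (4 * C / k) := by gcongr
      _ = 4 * C * (k : ℝ) ^ 2 := by
          push_cast
          field_simp
  have h5 := mul_le_mul_of_nonneg_left h3 (by positivity : 0 ≤ 2 * C)
  have h6 : (k : ℝ) ^ (-(21 / 10) : ℝ) * (k : ℝ) ^ 2 = (k : ℝ) ^ (-(1 / 10) : ℝ) := by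
    rw [← Real.rpow_natCast, ← Real.rpow_add hk0]
    norm_num
  have h7 : √(cubeDev μ X C k ω) = (k : ℝ) ^ (-(21 / 10) : ℝ) *
      √(((Nat.log 2 k + 1 : ℕ) + 2) * chainSum μ X C (k ^ 3) (Nat.log 2 k + 1) ω) := by
    have h : (k : ℝ) ^ (-(21 / 5) : ℝ) = ((k : ℝ) ^ (-(21 / 10) : ℝ)) ^ 2 := by
      rw [← Real.rpow_natCast, ← Real.rpow_mul hk0.le]
      norm_num
    rw [cubeDev, Real.sqrt_mul (by positivity), h, Real.sqrt_sq (by positivity)]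
  rw [h7, ← h6]
  calc _ ≤ (k : ℝ) ^ (-(21 / 10) : ℝ) *
        (√(((Nat.log 2 k + 1 : ℕ) + 2) * chainSum μ X C (k ^ 3) (Nat.log 2 k + 1) ω) +
          18 * C * (k : ℝ) ^ 2) := by
        gcongr
        linarith
    _ = _ := by ring

theorem abs_Bgen_rho1_sub_Bgen_rhoHat_le (hstat : StrictStationary μ X)
    (hmeas : ∀ j, Measurable (X j)) (hC : 0 ≤ C)
    (hbdd : ∀ n : ℕ, 1 ≤ n → ∀ ω, |X n ω| ≤ C) {n k : ℕ} (hk : 1 ≤ k) (hkn : k ^ 3 ≤ n)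
    (hnk : n < (k + 1) ^ 3) (ω : Ω) :
    |Bgen (fun _ i ω' => rho1 μ (X 1) (X i ω')) n ω -
        Bgen (fun m i ω' => rhoHat X m ω' (X i ω')) n ω| ≤
      2 * (√(cubeDev μ X C k ω) + 18 * C * (k : ℝ) ^ (-(1 / 10) : ℝ)) := by
  have hk0 : (0 : ℝ) < k := by exact_mod_cast hk
  have hn : 1 ≤ n := (Nat.one_le_pow _ _ hk).trans hkn
  have hn0 : (0 : ℝ) < n := by exact_mod_cast hn
  set E := √(cubeDev μ X C k ω) + 18 * C * (k : ℝ) ^ (-(1 / 10) : ℝ) with hE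
  have hE0 : 0 ≤ E := by positivity
  have hpow : (k : ℝ) ^ (-(21 / 10) : ℝ) * (k : ℝ) ^ (21 / 10 : ℝ) = 1 := by
    rw [← Real.rpow_add hk0]
    norm_num
  have hB := abs_Bgen_sub_Bgen_le (fun _ i ω' => rho1 μ (X 1) (X i ω'))
    (fun m i ω' => rhoHat X m ω' (X i ω')) hn ω (δ := (k : ℝ) ^ (21 / 10 : ℝ) * E / n)
    fun i hi => by
      have h := abs_devSum_le_of_cube_le hstat hmeas hC hbdd hk hkn hnk ω
        (hbdd i (Finset.mem_Icc.mp hi).1 ω)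
      rw [abs_sub_comm, rhoHat_sub_rho1 μ X hn, abs_div, abs_of_pos hn0]
      refine div_le_div_of_nonneg_right ?_ hn0.le
      calc |devSum μ X n ω (X i ω)| = (k : ℝ) ^ (21 / 10 : ℝ) *
            ((k : ℝ) ^ (-(21 / 10) : ℝ) * |devSum μ X n ω (X i ω)|) := by
            rw [← mul_assoc, mul_comm ((k : ℝ) ^ (21 / 10 : ℝ)), hpow, one_mul]
        _ ≤ _ := by gcongr
  refine hB.trans ?_
  have hkn' : (k : ℝ) ^ (21 / 10 : ℝ) ≤ (n : ℝ) ^ (7 / 10 : ℝ) := by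
    have h : (k : ℝ) ^ (21 / 10 : ℝ) = ((k : ℝ) ^ 3) ^ (7 / 10 : ℝ) := by
      rw [← Real.rpow_natCast, ← Real.rpow_mul hk0.le]
      norm_num
    rw [h]
    exact Real.rpow_le_rpow (by positivity) (by exact_mod_cast hkn) (by norm_num)
  have hprod : √(blockLen n : ℝ) * (k : ℝ) ^ (21 / 10 : ℝ) ≤ n := by
    calc √(blockLen n : ℝ) * (k : ℝ) ^ (21 / 10 : ℝ)
        ≤ (n : ℝ) ^ (3 / 10 : ℝ) * (n : ℝ) ^ (7 / 10 : ℝ) :=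
          mul_le_mul (sqrt_blockLen_le n) hkn' (by positivity) (by positivity)
      _ = n := by
          rw [← Real.rpow_add hn0]
          norm_num
  rw [← mul_div_assoc, div_le_iff₀ hn0]
  nlinarith [mul_le_mul_of_nonneg_right hprod hE0]

end Bounded

/-- The integer cube root `⌊n^{1/3}⌋`. -/
def cbrtFloor (n : ℕ) : ℕ := ⌊(n : ℝ) ^ (1 / 3 : ℝ)⌋₊

theorem cbrtFloor_pow_le (n : ℕ) : cbrtFloor n ^ 3 ≤ n := by
  have h := pow_le_pow_left₀ (Nat.cast_nonneg _)
    (Nat.floor_le (by positivity : 0 ≤ (n : ℝ) ^ (1 / 3 : ℝ))) 3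
  rw [← Real.rpow_natCast ((n : ℝ) ^ (1 / 3 : ℝ)), ← Real.rpow_mul (Nat.cast_nonneg n)] at h
  norm_num at h
  exact_mod_cast h

theorem lt_cbrtFloor_add_one_pow (n : ℕ) : n < (cbrtFloor n + 1) ^ 3 := by
  have h := pow_lt_pow_left₀ (Nat.lt_floor_add_one ((n : ℝ) ^ (1 / 3 : ℝ))) (by positivity)
    three_ne_zero
  rw [← Real.rpow_natCast ((n : ℝ) ^ (1 / 3 : ℝ)), ← Real.rpow_mul (Nat.cast_nonneg n)] at h
  norm_num at h
  exact_mod_cast h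

theorem tendsto_cbrtFloor : Tendsto cbrtFloor atTop atTop :=
  tendsto_nat_floor_atTop.comp
    ((tendsto_rpow_atTop (by norm_num)).comp tendsto_natCast_atTop_atTop)

/-- Consistency of the plug-in estimator (Section 5, comment (4)):
`|B_n − B̂_n| → 0` almost surely, where `B_n` uses `ρ₁(X_i)` and `B̂_n` uses the
empirical `ρ̂₁(X_i)`, with block length `ℓ_n = ⌊n^{3/5}⌋`, assuming
`∑_{j=n+1}^∞ Cov(X₁, Xⱼ) = O(n^{−4})`. -/
theorem Bn_hat_consistency (μ : Measure Ω) [IsProbabilityMeasure μ]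
    (X : ℕ → Ω → ℝ) (hmeas : ∀ j, Measurable (X j))
    (hstat : StrictStationary μ X) (hassoc : IsAssociated μ X)
    (C₁ : ℝ) (hbdd : ∀ n : ℕ, 1 ≤ n → ∀ ω, |X n ω| ≤ C₁)
    (hsum : Summable fun j : ℕ => cov μ (X 1) (X (j + 2)))
    (hcov : ∃ K : ℝ, ∀ n : ℕ, 1 ≤ n →
      ∑' i : ℕ, cov μ (X 1) (X (n + 1 + i)) ≤ K * (n : ℝ) ^ (-(4 : ℝ))) :
    ∀ᵐ ω ∂μ, Tendsto (fun n : ℕ =>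
        |Bgen (fun _ i ω' => rho1 μ (X 1) (X i ω')) n ω -
          Bgen (fun m i ω' => rhoHat X m ω' (X i ω')) n ω|) atTop (𝓝 0) := by
  obtain ⟨ω₀⟩ := nonempty_of_isProbabilityMeasure μ
  have hC : 0 ≤ C₁ := (abs_nonneg _).trans (hbdd 1 le_rfl ω₀)
  filter_upwards [ae_tendsto_cubeDev hstat hassoc hmeas hC hbdd hsum] with ω hω
  have hpow : Tendsto (fun k : ℕ => (k : ℝ) ^ (-(1 / 10) : ℝ)) atTop (𝓝 0) :=
    (tendsto_rpow_neg_atTop (by norm_num)).comp tendsto_natCast_atTop_atTop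
  have hlim : Tendsto (fun k : ℕ =>
      2 * (√(cubeDev μ X C₁ k ω) + 18 * C₁ * (k : ℝ) ^ (-(1 / 10) : ℝ))) atTop (𝓝 0) := by
    simpa using (hω.sqrt.add (hpow.const_mul (18 * C₁))).const_mul 2
  refine squeeze_zero' (Eventually.of_forall fun _ => abs_nonneg _) ?_
    (hlim.comp tendsto_cbrtFloor)
  filter_upwards [tendsto_cbrtFloor.eventually_ge_atTop 1] with n hn
  exact abs_Bgen_rho1_sub_Bgen_rhoHat_le hstat hmeas hC hbdd hn (cbrtFloor_pow_le n)
    (lt_cbrtFloor_add_one_pow n) ω
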